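/- Let ρ : ℝ → ℝ be a non-affine continuous function that is differentiable at some point c ∈ ℝ with ρ'(c) ≠ 0, applied componentwise. Suppose there exists a dense feedforward network of depth L and width W, with layers z ↦ ρ(W_k z + b_k) for W_k ∈ ℝ^{W×W} and b_k ∈ ℝ^W, achieving uniform error at most ε for a target function f on a compact set K ⊂ ℝ^W. Then for every δ > 0 there exists a DLoR network of width W and depth at most L·W achieving uniform error at most ε + δ on K, whose total parameter count is at most L·W·(3W + 1): each of its at most L·W layers stores one scalar α, two vectors u, v ∈ ℝ^W, and one bias vector in ℝ^W, i.e., 3W + 1 parameters per layer. In particular, the DLoR simulation uses O(L W^2) parameters, the same order as the L(W^2 + W) parameters of the original dense network. -/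

import Mathlib

/-- Forward pass of a dense feedforward network on `ℝ^W`: each layer is a pair
`(W_k, b_k)` and computes `z ↦ ρ(W_k z + b_k)` componentwise; the layers are applied
in list order. -/
noncomputable def denseForward (ρ : ℝ → ℝ) {N : ℕ}
    (layers : List (Matrix (Fin N) (Fin N) ℝ × (Fin N → ℝ))) (z : Fin N → ℝ) :
    Fin N → ℝ :=
  layers.foldl (fun s p => fun i => ρ (p.1.mulVec s i + p.2 i)) z

/-- Forward pass of a DLoR network on `ℝ^W`: each layer is described by the data
`(α, u, v, b)` — exactly `1 + 2W` parameters for the weight matrix `α I + u vᵀ`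
plus `W` parameters for the bias `b`, i.e. `3W + 1` parameters per layer — and
computes `z ↦ ρ((α I + u vᵀ) z + b)` componentwise. -/
noncomputable def dlorForward (ρ : ℝ → ℝ) {N : ℕ}
    (layers : List (ℝ × (Fin N → ℝ) × (Fin N → ℝ) × (Fin N → ℝ))) (z : Fin N → ℝ) :
    Fin N → ℝ :=
  layers.foldl
    (fun s p => fun i =>
      ρ (((p.1 • (1 : Matrix (Fin N) (Fin N) ℝ) +
            Matrix.vecMulVec p.2.1 p.2.2.1).mulVec s) i + p.2.2.2 i))
    z

open Filter Topology Matrix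

/-- The dense layer `z ↦ ρ(M z + b)` as a continuous map. -/
noncomputable def layerMap (ρ : C(ℝ, ℝ)) {N : ℕ}
    (p : Matrix (Fin N) (Fin N) ℝ × (Fin N → ℝ)) : C(Fin N → ℝ, Fin N → ℝ) :=
  ⟨fun z i => ρ (p.1.mulVec z i + p.2 i), by fun_prop⟩

@[simp]
theorem layerMap_apply (ρ : C(ℝ, ℝ)) {N : ℕ}
    (p : Matrix (Fin N) (Fin N) ℝ × (Fin N → ℝ)) (z : Fin N → ℝ) (i : Fin N) :
    layerMap ρ p z i = ρ (p.1.mulVec z i + p.2 i) := rfl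

theorem continuous_layerMap (ρ : C(ℝ, ℝ)) (N : ℕ) :
    Continuous (layerMap ρ (N := N)) := by
  refine ContinuousMap.continuous_of_continuous_uncurry _ ?_
  refine continuous_pi fun i => ?_
  simp only [Function.uncurry_def, layerMap_apply]
  fun_prop

/-- The continuous maps computed by DLoR networks of width `N` and depth `m`. -/
def dlorNets (ρ : C(ℝ, ℝ)) (N m : ℕ) : Set C(Fin N → ℝ, Fin N → ℝ) :=
  {g | ∃ layers : List (ℝ × (Fin N → ℝ) × (Fin N → ℝ) × (Fin N → ℝ)),
    layers.length = m ∧ ⇑g = dlorForward ρ layers}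

theorem id_mem_dlorNets (ρ : C(ℝ, ℝ)) (N : ℕ) :
    ContinuousMap.id (Fin N → ℝ) ∈ dlorNets ρ N 0 :=
  ⟨[], rfl, rfl⟩

theorem layerMap_mem_dlorNets (ρ : C(ℝ, ℝ)) {N : ℕ} (α : ℝ) (u v b : Fin N → ℝ) :
    layerMap ρ (α • 1 + vecMulVec u v, b) ∈ dlorNets ρ N 1 :=
  ⟨[(α, u, v, b)], rfl, rfl⟩

theorem comp_mem_closure_dlorNets {ρ : C(ℝ, ℝ)} {N m m' : ℕ}
    {g g' : C(Fin N → ℝ, Fin N → ℝ)} (hg : g ∈ closure (dlorNets ρ N m))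
    (hg' : g' ∈ closure (dlorNets ρ N m')) :
    g'.comp g ∈ closure (dlorNets ρ N (m + m')) := by
  refine map_mem_closure₂ (f := fun g g' : C(Fin N → ℝ, Fin N → ℝ) => g'.comp g)
    (ContinuousMap.continuous_comp'.comp continuous_id) hg hg' ?_
  rintro a ⟨l, hl, ha⟩ a' ⟨l', hl', ha'⟩
  refine ⟨l ++ l', by simp [hl, hl'], ?_⟩
  ext1 z
  simp [ha, ha', dlorForward]

/-- The matrix whose first `k` rows are those of `A` and whose other rows are those of the
identity. -/
def rowMix {R : Type*} [Zero R] [One R] {N : ℕ} (A : Matrix (Fin N) (Fin N) R) (k : ℕ) :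
    Matrix (Fin N) (Fin N) R :=
  Matrix.of fun i j => if i.val < k then A i j else (1 : Matrix (Fin N) (Fin N) R) i j

theorem rowMix_zero {R : Type*} [Zero R] [One R] {N : ℕ} (A : Matrix (Fin N) (Fin N) R) :
    rowMix A 0 = 1 := by
  ext i j
  simp [rowMix]

theorem rowMix_self {R : Type*} [Zero R] [One R] {N : ℕ} (A : Matrix (Fin N) (Fin N) R) :
    rowMix A N = A := by
  ext i j
  simp [rowMix]

theorem rowMix_one {R : Type*} [Zero R] [One R] {N : ℕ} (k : ℕ) :
    rowMix (1 : Matrix (Fin N) (Fin N) R) k = 1 := by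
  ext i j
  simp [rowMix]

theorem rowMix_map {R S : Type*} [Semiring R] [Semiring S] (f : R →+* S) {N : ℕ}
    (A : Matrix (Fin N) (Fin N) R) (k : ℕ) :
    (rowMix A k).map f = rowMix (A.map f) k := by
  ext i j
  simp [rowMix, Matrix.one_apply, apply_ite f]

theorem exists_rowMix_succ_eq_mul {N : ℕ} (A : Matrix (Fin N) (Fin N) ℝ) {k : ℕ} (hk : k < N)
    (hdet : (rowMix A k).det ≠ 0) :
    ∃ u v : Fin N → ℝ,
      rowMix A (k + 1) = ((1 : ℝ) • 1 + vecMulVec u v) * rowMix A k := by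
  let w : Fin N → ℝ := A ⟨k, hk⟩ - (1 : Matrix (Fin N) (Fin N) ℝ) ⟨k, hk⟩
  refine ⟨Pi.single ⟨k, hk⟩ 1, w ᵥ* (rowMix A k)⁻¹, ?_⟩
  rw [one_smul, add_mul, one_mul, vecMulVec_mul, vecMul_vecMul,
    Matrix.nonsing_inv_mul _ (isUnit_iff_ne_zero.mpr hdet), vecMul_one]
  ext i j
  rcases lt_trichotomy i.val k with h | h | h
  · have hne : i ≠ ⟨k, hk⟩ := fun e => by simp [e] at h
    simp [rowMix, vecMulVec_apply, h, hne, h.le]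
  · obtain rfl : i = ⟨k, hk⟩ := Fin.ext h
    simp [rowMix, vecMulVec_apply, w]
  · have hne : i ≠ ⟨k, hk⟩ := fun e => by simp [e] at h
    simp [rowMix, vecMulVec_apply, hne, h.not_gt, h.not_ge]

theorem eventually_det_rowMix_ne_zero {N : ℕ} (A : Matrix (Fin N) (Fin N) ℝ) (k : ℕ) :
    ∀ᶠ t in 𝓝[≠] (0 : ℝ), (rowMix (A + t • (1 - A)) k).det ≠ 0 := by
  open Polynomial in
  let P : ℝ[X] := (rowMix (A.map C + (X : ℝ[X]) • (1 - A.map C)) k).det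
  have hP : ∀ t : ℝ, P.eval t = (rowMix (A + t • (1 - A)) k).det := by
    intro t
    rw [← Polynomial.coe_evalRingHom, RingHom.map_det, RingHom.mapMatrix_apply, rowMix_map]
    congr 2
    ext i j
    simp [Matrix.one_apply, apply_ite (Polynomial.eval t)]
  have hP0 : P ≠ 0 := by
    intro h
    have h1 := hP 1
    simp [h, rowMix_one] at h1
  filter_upwards [nhdsNE_le_cofinite 0
    (Polynomial.finite_setOfPred_isRoot hP0).compl_mem_cofinite] with t ht
  rwa [← hP]

theorem layerMap_mul_rowMix_mem_closure {ρ : C(ℝ, ℝ)} {c : ℝ} (hdiff : DifferentiableAt ℝ ρ c)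
    (hd : deriv ρ c ≠ 0) {N : ℕ} (A : Matrix (Fin N) (Fin N) ℝ)
    (hA : ∀ k < N, (rowMix A k).det ≠ 0) (k : ℕ) (hk : k < N) (α : ℝ) (u v b : Fin N → ℝ) :
    layerMap ρ ((α • 1 + vecMulVec u v) * rowMix A k, b) ∈ closure (dlorNets ρ N (k + 1)) := by
  induction k generalizing α u v b with
  | zero =>
    rw [rowMix_zero, mul_one]
    exact subset_closure (layerMap_mem_dlorNets ρ α u v b)
  | succ k ih =>
    obtain ⟨u', v', hS⟩ := exists_rowMix_succ_eq_mul A (k.lt_succ_self.trans hk)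
      (hA k (k.lt_succ_self.trans hk))
    have hslope : Continuous (dslope ρ c) := by
      rw [← continuousOn_univ, continuousOn_dslope univ_mem]
      exact ⟨ρ.continuous.continuousOn, hdiff⟩
    set B := rowMix A (k + 1)
    set M : Matrix (Fin N) (Fin N) ℝ := α • 1 + vecMulVec u v with hM
    let F : ℝ → (Fin N → ℝ) → Fin N → ℝ := fun η z i =>
      ρ ((M *ᵥ fun j => (B *ᵥ z) j * dslope ρ c (c + η * (B *ᵥ z) j) / deriv ρ c) i + b i)
    have hF : Continuous (Function.uncurry F) := by
      refine continuous_pi fun i => ?_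
      simp only [Function.uncurry_def, F]
      fun_prop
    let E : ℝ → C(Fin N → ℝ, Fin N → ℝ) := fun η => ⟨F η, by fun_prop⟩
    have hE : Continuous E := ContinuousMap.continuous_of_continuous_uncurry _ hF
    have hE0 : E 0 = layerMap ρ (M * B, b) := by
      ext z i
      simp [E, F, hd, dslope_same]
    rw [← hE0]
    refine isClosed_closure.mem_of_tendsto (b := 𝓝[≠] (0 : ℝ)) ((hE.tendsto 0).mono_left nhdsWithin_le_nhds) ?_
    filter_upwards [self_mem_nhdsWithin] with η (hη : η ≠ 0)
    have h1 := ih (k.lt_succ_self.trans hk) η (η • u') v' fun _ => c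
    have h2 := subset_closure (layerMap_mem_dlorNets ρ ((η * deriv ρ c)⁻¹ * α)
      ((η * deriv ρ c)⁻¹ • u) v (b - M *ᵥ fun _ => (η * deriv ρ c)⁻¹ * ρ c))
    have h3 := comp_mem_closure_dlorNets h1 h2
    have hB : (η • (1 : Matrix (Fin N) (Fin N) ℝ) + vecMulVec (η • u') v') * rowMix A k = η • B := by
      rw [hS, smul_vecMulVec, ← smul_mul_assoc, smul_add, one_smul]
    have hM' : ((η * deriv ρ c)⁻¹ * α) • (1 : Matrix (Fin N) (Fin N) ℝ) +
        vecMulVec ((η * deriv ρ c)⁻¹ • u) v = (η * deriv ρ c)⁻¹ • M := by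
      rw [hM, smul_vecMulVec, smul_add, smul_smul]
    rw [hB, hM'] at h3
    convert h3 using 1
    ext z i
    have hy : (fun j => (B *ᵥ z) j * dslope ρ c (c + η * (B *ᵥ z) j) / deriv ρ c) =
        (η * deriv ρ c)⁻¹ • (layerMap ρ (η • B, fun _ => c) z) -
          fun _ => (η * deriv ρ c)⁻¹ * ρ c := by
      ext j
      have h := sub_smul_dslope ρ c (c + η * (B *ᵥ z) j)
      simp only [add_sub_cancel_left, smul_eq_mul] at h
      simp only [Pi.sub_apply, Pi.smul_apply, layerMap_apply, smul_mulVec, smul_eq_mul]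
      rw [add_comm (η * _) c, ← mul_sub, ← h]
      field_simp
    simp only [E, F, ContinuousMap.coe_mk, ContinuousMap.comp_apply]
    rw [hy, mulVec_sub, layerMap_apply ρ (_, _)]
    simp only [mulVec_smul, smul_mulVec, Pi.sub_apply]
    congr 1
    ring

theorem layerMap_mem_closure_dlorNets {ρ : C(ℝ, ℝ)} {c : ℝ} (hdiff : DifferentiableAt ℝ ρ c)
    (hd : deriv ρ c ≠ 0) {N : ℕ} (A : Matrix (Fin N) (Fin N) ℝ) (b : Fin N → ℝ) :
    layerMap ρ (A, b) ∈ closure (dlorNets ρ N N) := by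
  obtain _ | n := N
  · rw [Subsingleton.elim (layerMap ρ (A, b)) (ContinuousMap.id _)]
    exact subset_closure (id_mem_dlorNets ρ 0)
  have hcont : Continuous fun t : ℝ => layerMap ρ (A + t • (1 - A), b) :=
    (continuous_layerMap ρ _).comp (by fun_prop)
  have h0 : layerMap ρ (A, b) = layerMap ρ (A + (0 : ℝ) • (1 - A), b) := by simp
  rw [h0]
  refine isClosed_closure.mem_of_tendsto (b := 𝓝[≠] (0 : ℝ)) ((hcont.tendsto 0).mono_left nhdsWithin_le_nhds) ?_
  have hev : ∀ᶠ t in 𝓝[≠] (0 : ℝ), ∀ k ∈ Set.Iio (n + 1),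
      (rowMix (A + t • (1 - A)) k).det ≠ 0 :=
    (Set.finite_Iio _).eventually_all.mpr fun k _ => eventually_det_rowMix_ne_zero A k
  filter_upwards [hev] with t ht
  obtain ⟨u, v, hS⟩ := exists_rowMix_succ_eq_mul _ n.lt_succ_self (ht n n.lt_succ_self)
  have h := layerMap_mul_rowMix_mem_closure hdiff hd _ ht n n.lt_succ_self 1 u v b
  rwa [← hS, rowMix_self] at h

theorem exists_mem_closure_dlorNets_eq_denseForward {ρ : C(ℝ, ℝ)} {c : ℝ}
    (hdiff : DifferentiableAt ℝ ρ c) (hd : deriv ρ c ≠ 0) {N : ℕ}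
    (layers : List (Matrix (Fin N) (Fin N) ℝ × (Fin N → ℝ))) :
    ∃ g ∈ closure (dlorNets ρ N (layers.length * N)), ⇑g = denseForward ρ layers := by
  induction layers with
  | nil =>
    refine ⟨ContinuousMap.id _, subset_closure ?_, rfl⟩
    simpa using id_mem_dlorNets ρ N
  | cons p layers ih =>
    obtain ⟨g, hg, hgl⟩ := ih
    refine ⟨g.comp (layerMap ρ p), ?_, ?_⟩
    · rw [List.length_cons, add_mul, one_mul, add_comm]
      exact comp_mem_closure_dlorNets (layerMap_mem_closure_dlorNets hdiff hd p.1 p.2) hg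
    · rw [ContinuousMap.coe_comp, hgl]
      rfl

theorem exists_dlorForward_dist_lt {ρ : C(ℝ, ℝ)} {N m : ℕ} {g : C(Fin N → ℝ, Fin N → ℝ)}
    (hg : g ∈ closure (dlorNets ρ N m)) {K : Set (Fin N → ℝ)} (hK : IsCompact K)
    {δ : ℝ} (hδ : 0 < δ) :
    ∃ layers : List (ℝ × (Fin N → ℝ) × (Fin N → ℝ) × (Fin N → ℝ)),
      layers.length = m ∧ ∀ x ∈ K, dist (g x) (dlorForward ρ layers x) < δ := by
  have : (𝓝[dlorNets ρ N m] g).NeBot := mem_closure_iff_nhdsWithin_neBot.mp hg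
  have ht : Tendsto id (𝓝[dlorNets ρ N m] g) (𝓝 g) := nhdsWithin_le_nhds
  have hu := Metric.tendstoUniformlyOn_iff.mp
    (ContinuousMap.tendsto_iff_forall_isCompact_tendstoUniformlyOn.mp ht K hK) δ hδ
  obtain ⟨g', hg', layers, hl, hg'l⟩ := (hu.and self_mem_nhdsWithin).exists
  refine ⟨layers, hl, fun x hx => ?_⟩
  rw [← hg'l]
  exact hg' x hx


/-- Parameter complexity of the DLoR simulation: if a dense
feedforward network of depth `L` and width `W`, with non-affine continuous
activation `ρ` differentiable at some `c` with `ρ'(c) ≠ 0`, achieves uniform error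
at most `ε` for a target `f` on a compact `K ⊆ ℝ^W`, then for every `δ > 0` there
is a DLoR network of width `W` and depth at most `L·W` achieving uniform error at
most `ε + δ`, whose total parameter count — `3W + 1` parameters for each of its
layers — is at most `L·W·(3W + 1)`. -/
theorem stmt16 (ρ : ℝ → ℝ) (hρc : Continuous ρ)
    (hna : ¬ ∃ a b : ℝ, ∀ x, ρ x = a * x + b)
    (c : ℝ) (hdiff : DifferentiableAt ℝ ρ c) (hd : deriv ρ c ≠ 0)
    (Wd : ℕ) (K : Set (Fin Wd → ℝ)) (hK : IsCompact K)
    (L : ℕ) (Wk : Fin L → Matrix (Fin Wd) (Fin Wd) ℝ) (bk : Fin L → Fin Wd → ℝ)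
    (f : (Fin Wd → ℝ) → Fin Wd → ℝ) (ε : ℝ)
    (happrox : ∀ x ∈ K,
      ‖denseForward ρ (List.ofFn fun k => (Wk k, bk k)) x - f x‖ ≤ ε) :
    ∀ δ > (0 : ℝ),
      ∃ layers : List (ℝ × (Fin Wd → ℝ) × (Fin Wd → ℝ) × (Fin Wd → ℝ)),
        layers.length ≤ L * Wd ∧
        layers.length * (3 * Wd + 1) ≤ L * Wd * (3 * Wd + 1) ∧
        ∀ x ∈ K, ‖dlorForward ρ layers x - f x‖ ≤ ε + δ := by
  intro δ hδ
  obtain ⟨g, hg, hgl⟩ := exists_mem_closure_dlorNets_eq_denseForward (ρ := ⟨ρ, hρc⟩) hdiff hd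
    (List.ofFn fun k => (Wk k, bk k))
  obtain ⟨layers, hl, hlt⟩ := exists_dlorForward_dist_lt hg hK hδ
  rw [List.length_ofFn] at hl
  refine ⟨layers, hl.le, by rw [hl], fun x hx => ?_⟩
  have h1 := happrox x hx
  have h2 := hlt x hx
  rw [hgl] at h2
  rw [← dist_eq_norm] at h1 ⊢
  exact (dist_triangle_left _ _ _).trans
    ((add_le_add h2.le h1).trans_eq (add_comm _ _))
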